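/- Let p = 2^m + 1 be a Fermat prime and let q be any power of p. For every integer n ≥ 1 there exists an irreducible subgroup G of GL(d,q) with d = (p−1)·p^{n−1} such that (p−1)^2·c_p(G) = p·d − (p−1); equivalently c_p(G) = (ε·d − 1)/(p−1) with ε = p/(p−1). -/

import Mathlib

/-- A composition series of a group `G`: an ascending chain of subgroups from `⊥` to `⊤`
in which each term is normal in the next, with simple quotients. -/
structure GroupCompSeries (G : Type*) [Group G] where
  len : ℕ
  ser : Fin (len + 1) → Subgroup G
  ser_bot : ser 0 = ⊥
  ser_top : ser (Fin.last len) = ⊤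
  ser_le : ∀ i : Fin len, ser i.castSucc ≤ ser i.succ
  ser_normal : ∀ i : Fin len, ((ser i.castSucc).subgroupOf (ser i.succ)).Normal
  ser_simple : ∀ i : Fin len,
    haveI := ser_normal i
    IsSimpleGroup (↥(ser i.succ) ⧸ (ser i.castSucc).subgroupOf (ser i.succ))

/-- The number of factors of order `p` in a composition series. -/
noncomputable def GroupCompSeries.count {G : Type*} [Group G]
    (S : GroupCompSeries G) (p : ℕ) : ℕ := by
  classical
  exact (Finset.univ.filter fun i : Fin S.len =>
    Nat.card (↥(S.ser i.succ) ⧸ (S.ser i.castSucc).subgroupOf (S.ser i.succ)) = p).card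

/-- `cp p G` is the number of composition factors of `G` of order `p`, counted with
multiplicity in a composition series (well defined by Jordan–Hölder). -/
noncomputable def cp (p : ℕ) (G : Type*) [Group G] : ℕ := by
  classical
  exact if h : Nonempty (GroupCompSeries G) then h.some.count p else 0

/-- The constant `ε_q` of Theorem 1, for `q = p ^ f`. -/
noncomputable def epsq (p f : ℕ) : ℚ := by
  classical
  exact if p = 2 ∧ Even f then 4 / 3
    else if ∃ n : ℕ, p = 2 ^ 2 ^ n + 1 then p / (p - 1)
    else 1

/-- A subgroup of `GL(d, F)` acts irreducibly on its natural module. -/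
def natIrreducible {F : Type*} [Field F] {d : ℕ}
    (G : Subgroup (Matrix.GeneralLinearGroup (Fin d) F)) : Prop :=
  (⊥ : Submodule F (Fin d → F)) ≠ ⊤ ∧
  ∀ W : Submodule F (Fin d → F),
    (∀ g ∈ G, ∀ v ∈ W, Matrix.mulVec (g : Matrix (Fin d) (Fin d) F) v ∈ W) →
      W = ⊥ ∨ W = ⊤

/-- `A` is normal in `B` with simple quotient. -/
def IsSimpleStep {G : Type*} [Group G] (A B : Subgroup G) : Prop :=
  A ≤ B ∧ ∃ _ : (A.subgroupOf B).Normal, IsSimpleGroup (↥B ⧸ A.subgroupOf B)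

/-- A finite group has a composition series reaching any prescribed subgroup. -/
theorem exists_subgroup_chain {G : Type*} [Group G] [Finite G] (H : Subgroup G) :
    ∃ (len : ℕ) (s : ℕ → Subgroup G), s 0 = ⊥ ∧ s len = H ∧
      ∀ i < len, IsSimpleStep (s i) (s (i + 1)) := by
  induction hc : Nat.card H using Nat.strong_induction_on generalizing H with
  | _ c ih =>
  subst hc
  by_cases hH : H = ⊥
  · exact ⟨0, fun _ => ⊥, rfl, hH.symm, fun i hi => absurd hi (Nat.not_lt_zero i)⟩
  have : Nontrivial H := (Subgroup.nontrivial_iff_ne_bot H).2 hH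
  obtain ⟨N, ⟨hNn, hNt⟩, hmax⟩ :=
    (Set.toFinite {N : Subgroup H | N.Normal ∧ N ≠ ⊤}).exists_maximal
      ⟨⊥, inferInstance, bot_ne_top⟩
  have hsimple : IsSimpleGroup (H ⧸ N) := by
    have : Nontrivial (H ⧸ N) := QuotientGroup.nontrivial_iff.2 hNt
    refine ⟨fun M hM => ?_⟩
    have hle : N ≤ M.comap (QuotientGroup.mk' N) := fun x hx => by
      simp [Subgroup.mem_comap, (QuotientGroup.eq_one_iff x).2 hx, M.one_mem]
    have hmap : (M.comap (QuotientGroup.mk' N)).map (QuotientGroup.mk' N) = M :=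
      Subgroup.map_comap_eq_self_of_surjective (QuotientGroup.mk'_surjective N) M
    by_cases ht : M.comap (QuotientGroup.mk' N) = ⊤
    · right
      rw [← hmap, ht, Subgroup.map_top_of_surjective _ (QuotientGroup.mk'_surjective N)]
    · left
      have heq := le_antisymm (hmax ⟨hM.comap _, ht⟩ hle) hle
      rw [← hmap, heq, QuotientGroup.map_mk'_self]
  have hsub : (N.map H.subtype).subgroupOf H = N :=
    Subgroup.comap_map_eq_self_of_injective H.subtype_injective N
  have hcard : Nat.card (N.map H.subtype) < Nat.card H := by
    rw [Nat.card_congr (N.equivMapOfInjective _ H.subtype_injective).toEquiv.symm]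
    exact lt_of_le_of_ne (Nat.card_le_card_of_injective _ N.subtype_injective)
      fun h => hNt (Subgroup.eq_top_of_card_eq N h)
  obtain ⟨len, s, h0, hl, hs⟩ := ih _ hcard (N.map H.subtype) rfl
  refine ⟨len + 1, fun i => if i ≤ len then s i else H, by simpa using h0, by simp, ?_⟩
  intro i hi
  rcases Nat.lt_succ_iff_lt_or_eq.1 hi with hi' | rfl
  · simpa [hi'.le, Nat.succ_le_of_lt hi'] using hs i hi'
  · simp only [le_refl, if_true, hl, Nat.not_succ_le_self, if_false]
    unfold IsSimpleStep
    refine ⟨Subgroup.map_subtype_le N, ?_⟩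
    rw [hsub]
    exact ⟨hNn, hsimple⟩

theorem nonempty_groupCompSeries (G : Type*) [Group G] [Finite G] :
    Nonempty (GroupCompSeries G) := by
  obtain ⟨len, s, h0, hl, hs⟩ := exists_subgroup_chain (⊤ : Subgroup G)
  exact ⟨⟨len, fun i => s i, h0, hl, fun i => (hs i i.2).1, fun i => (hs i i.2).2.1,
    fun i => (hs i i.2).2.2⟩⟩

theorem GroupCompSeries.prod_card {G : Type*} [Group G] (S : GroupCompSeries G) :
    ∏ i : Fin S.len, Nat.card (↥(S.ser i.succ) ⧸ (S.ser i.castSucc).subgroupOf (S.ser i.succ)) =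
      Nat.card G := by
  have key : ∀ i : Fin (S.len + 1),
      ∏ j : Fin S.len with j.castSucc < i,
        Nat.card (↥(S.ser j.succ) ⧸ (S.ser j.castSucc).subgroupOf (S.ser j.succ)) =
      Nat.card (S.ser i) := by
    intro i
    induction i using Fin.induction with
    | zero => simp [S.ser_bot]
    | succ i ih =>
      have hset : (Finset.univ.filter fun j : Fin S.len => j.castSucc < i.succ) =
          insert i (Finset.univ.filter fun j : Fin S.len => j.castSucc < i.castSucc) := by
        ext j
        simp only [Finset.mem_filter, Finset.mem_univ, true_and, Finset.mem_insert, Fin.lt_def,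
          Fin.val_castSucc, Fin.val_succ, Fin.ext_iff]
        omega
      rw [hset, Finset.prod_insert (by simp), ih,
        Subgroup.card_eq_card_quotient_mul_card_subgroup
          ((S.ser i.castSucc).subgroupOf (S.ser i.succ)),
        Nat.card_congr (Subgroup.subgroupOfEquivOfLe (S.ser_le i)).toEquiv]
  have := key (Fin.last S.len)
  rw [S.ser_top, Subgroup.card_top] at this
  rw [← this]
  congr 1
  ext j
  simp [Fin.castSucc_lt_last]

/-- In a finite solvable group the number of composition factors of order `p` is the exponent
of `p` in the order of the group. -/
theorem cp_eq_factorization_card {G : Type*} [Group G] [Finite G] [Group.IsSolvable G] (p : ℕ) :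
    cp p G = (Nat.card G).factorization p := by
  classical
  have hne := nonempty_groupCompSeries G
  rw [cp, dif_pos hne]
  generalize hne.some = S
  have hprime : ∀ i : Fin S.len, (Nat.card (↥(S.ser i.succ) ⧸
      (S.ser i.castSucc).subgroupOf (S.ser i.succ))).Prime := by
    intro i
    have := S.ser_normal i
    have := S.ser_simple i
    have hcomm := IsSimpleGroup.comm_iff_isSolvable.2
      (inferInstance : Group.IsSolvable (↥(S.ser i.succ) ⧸
        (S.ser i.castSucc).subgroupOf (S.ser i.succ)))
    let _ : CommGroup (↥(S.ser i.succ) ⧸ (S.ser i.castSucc).subgroupOf (S.ser i.succ)) :=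
      { (inferInstance : Group _) with mul_comm := hcomm }
    exact IsSimpleGroup.prime_card
  rw [← S.prod_card, Nat.factorization_prod_apply fun i _ => (hprime i).ne_zero,
    GroupCompSeries.count, Finset.card_filter]
  refine Finset.sum_congr rfl fun i _ => ?_
  rw [(hprime i).factorization, Finsupp.single_apply]

/-- A faithful irreducible linear representation whose image contains `-1`. -/
structure IsFaithfulIrredWithNeg {F G V : Type*} [Field F] [Group G] [AddCommGroup V] [Module F V]
    (ρ : G →* Module.End F V) : Prop where
  injective : Function.Injective ρ
  irreducible : ∀ W : Submodule F V, (∀ g, ∀ v ∈ W, ρ g v ∈ W) → W = ⊥ ∨ W = ⊤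
  neg_one : ∃ z, ρ z = -1

/-- The imprimitive representation of a regular wreath product `G ≀ᵣ C` on `C → V`. -/
def wreathRep {F G V : Type*} [Field F] [Group G] [AddCommGroup V] [Module F V]
    (ρ : G →* Module.End F V) (C : Type*) [Group C] : G ≀ᵣ C →* Module.End F (C → V) where
  toFun w :=
    { toFun := fun f x => ρ (w.left x) (f (w.right⁻¹ * x))
      map_add' := fun f g => by ext x; simp
      map_smul' := fun a f => by ext x; simp }
  map_one' := by ext; simp
  map_mul' w₁ w₂ := by
    refine LinearMap.ext fun f => funext fun x => ?_
    simp [mul_assoc]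

theorem wreathRep_apply {F G V C : Type*} [Field F] [Group G] [AddCommGroup V] [Module F V]
    [Group C] (ρ : G →* Module.End F V) (w : G ≀ᵣ C) (f : C → V) (x : C) :
    wreathRep ρ C w f x = ρ (w.left x) (f (w.right⁻¹ * x)) := rfl

theorem IsFaithfulIrredWithNeg.wreathRep {F G V C : Type*} [Field F] [Group G] [AddCommGroup V]
    [Module F V] [Nontrivial V] [Group C] [Finite C] (h2 : (2 : F) ≠ 0) {ρ : G →* Module.End F V}
    (hρ : IsFaithfulIrredWithNeg ρ) : IsFaithfulIrredWithNeg (wreathRep ρ C) := by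
  classical
  have := Fintype.ofFinite C
  obtain ⟨z, hz⟩ := hρ.neg_one
  refine ⟨(injective_iff_map_eq_one _).2 fun w hw => ?_, fun W hW => ?_, ⟨⟨fun _ => z, 1⟩, ?_⟩⟩
  · have happ : ∀ (f : C → V) x, ρ (w.left x) (f (w.right⁻¹ * x)) = f x := fun f x => by
      rw [← wreathRep_apply, hw, Module.End.one_apply]
    have hright : w.right = 1 := by
      by_contra hne
      obtain ⟨v, hv⟩ := exists_ne (0 : V)
      have := happ (Pi.single w.right v) w.right
      rw [inv_mul_cancel, Pi.single_eq_same, Pi.single_eq_of_ne (Ne.symm hne), map_zero] at this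
      exact hv this.symm
    refine RegularWreathProduct.ext (funext fun x => ?_) hright
    refine hρ.injective (LinearMap.ext fun v => ?_)
    simpa [hright] using happ (fun _ => v) x
  · by_cases hbot : W = ⊥
    · exact Or.inl hbot
    right
    obtain ⟨f, hf, hf0⟩ := W.exists_mem_ne_zero_of_ne_bot hbot
    obtain ⟨c, hc⟩ := Function.ne_iff.1 hf0
    -- comparing `f` with its image under `-1` at `c` isolates the coordinate `c`
    have hsingle : Pi.single c (f c) ∈ W := by
      have hmem := W.sub_mem hf (hW ⟨Pi.mulSingle c z, 1⟩ f hf)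
      have heq : f - _root_.wreathRep ρ C ⟨Pi.mulSingle c z, 1⟩ f
          = (2 : F) • Pi.single c (f c) := by
        ext x
        by_cases hx : x = c
        · subst hx
          simp [wreathRep_apply, hz, two_smul]
        · simp [wreathRep_apply, hx]
      rw [heq] at hmem
      exact (W.smul_mem_iff h2).1 hmem
    have hfull : W.comap (LinearMap.single F (fun _ : C => V) c) = ⊤ := by
      refine (hρ.irreducible _ fun g v hv => ?_).resolve_left fun h => ?_
      · have := hW ⟨fun _ => g, 1⟩ _ hv
        rw [Submodule.mem_comap]
        convert this using 1
        ext x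
        by_cases hx : x = c
        · subst hx
          simp [wreathRep_apply]
        · simp [wreathRep_apply, hx]
      · have : f c ∈ W.comap (LinearMap.single F (fun _ : C => V) c) := hsingle
        rw [h, Submodule.mem_bot] at this
        exact hc this
    have hall : ∀ (x : C) (v : V), Pi.single x v ∈ W := by
      intro x v
      have hv : v ∈ W.comap (LinearMap.single F (fun _ : C => V) c) := hfull ▸ Submodule.mem_top
      have := hW ⟨1, x * c⁻¹⟩ _ hv
      convert this using 1
      ext y
      by_cases hy : y = x
      · subst hy
        simp [wreathRep_apply]
      · have : c * x⁻¹ * y ≠ c := by simpa [mul_assoc, inv_mul_eq_one, eq_comm] using hy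
        simp [wreathRep_apply, hy, this]
    refine eq_top_iff.2 fun g _ => ?_
    rw [← Finset.univ_sum_single g]
    exact W.sum_mem fun x _ => hall x _
  · refine LinearMap.ext fun f => funext fun x => ?_
    simp [wreathRep_apply, hz]

theorem isSolvable_function {G : Type*} (ι : Type*) [Group G] [hG : Group.IsSolvable G] :
    Group.IsSolvable (ι → G) := by
  obtain ⟨n, hn⟩ := (Group.isSolvable_def G).1 hG
  refine (Group.isSolvable_def _).2 ⟨n, (Subgroup.eq_bot_iff_forall _).2 fun f hf => ?_⟩
  funext i
  have := map_derivedSeries_le_derivedSeries (Pi.evalMonoidHom (fun _ : ι => G) i) n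
    (Subgroup.mem_map_of_mem _ hf)
  rwa [hn, Subgroup.mem_bot] at this

instance RegularWreathProduct.instIsSolvable {G C : Type*} [Group G] [Group C]
    [Group.IsSolvable G] [Group.IsSolvable C] : Group.IsSolvable (G ≀ᵣ C) := by
  let inBase : (C → G) →* G ≀ᵣ C :=
    { toFun := fun f => ⟨f, 1⟩
      map_one' := rfl
      map_mul' := fun f g => by ext <;> simp }
  have := isSolvable_function (G := G) C
  exact Group.isSolvable_of_ker_le_range inBase RegularWreathProduct.rightHom
    fun w hw => ⟨w.left, RegularWreathProduct.ext rfl (MonoidHom.mem_ker.1 hw).symm⟩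

/-- Over `F` there is a finite solvable group of order with `p`-exponent `c` and a faithful
irreducible representation of degree `d` whose image contains `-1`. -/
def HasSolvableIrrep (F : Type) [Field F] (p d c : ℕ) : Prop :=
  ∃ (G : Type) (_ : Group G) (V : Type) (_ : AddCommGroup V) (_ : Module F V)
    (ρ : G →* Module.End F V), Finite G ∧ Group.IsSolvable G ∧ (Nat.card G).factorization p = c ∧
      0 < Module.finrank F V ∧ Module.finrank F V = d ∧ IsFaithfulIrredWithNeg ρ

theorem HasSolvableIrrep.wreath {F : Type} [Field F] {p d c : ℕ} (hp : p.Prime) (h2 : (2 : F) ≠ 0)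
    (h : HasSolvableIrrep F p d c) : HasSolvableIrrep F p (p * d) (p * c + 1) := by
  obtain ⟨G, _, V, _, _, ρ, _, _, hc, hpos, hd, hρ⟩ := h
  have : NeZero p := ⟨hp.ne_zero⟩
  have : Module.Finite F V := Module.finite_of_finrank_pos hpos
  have : Nontrivial V := Module.nontrivial_of_finrank_pos hpos
  have hfin : Module.finrank F (Multiplicative (ZMod p) → V) = p * d := by
    rw [Module.finrank_pi_fintype]
    simp [hd]
  refine ⟨G ≀ᵣ Multiplicative (ZMod p), inferInstance, Multiplicative (ZMod p) → V, inferInstance,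
    inferInstance, wreathRep ρ _, inferInstance, inferInstance, ?_, ?_, hfin, hρ.wreathRep h2⟩
  · have hcard : Nat.card (Multiplicative (ZMod p)) = p := by simp
    rw [RegularWreathProduct.card, hcard,
      Nat.factorization_mul (pow_ne_zero _ Nat.card_pos.ne') hp.ne_zero,
      Nat.factorization_pow, Finsupp.add_apply, Finsupp.smul_apply, hc, hp.factorization_self,
      smul_eq_mul]
  · rw [hfin, ← hd]
    exact Nat.mul_pos hp.pos hpos

theorem HasSolvableIrrep.exists_subgroup {F : Type} [Field F] {p d c : ℕ}
    (h : HasSolvableIrrep F p d c) :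
    ∃ G : Subgroup (Matrix.GeneralLinearGroup (Fin d) F), natIrreducible G ∧ cp p ↥G = c := by
  obtain ⟨G, _, V, _, _, ρ, _, _, hc, hpos, hd, hρ⟩ := h
  have : Module.Finite F V := Module.finite_of_finrank_pos hpos
  have : Nontrivial V := Module.nontrivial_of_finrank_pos hpos
  let b : Module.Basis (Fin d) F V := Module.finBasisOfFinrankEq F V hd
  let φ : G →* Matrix.GeneralLinearGroup (Fin d) F :=
    MonoidHom.toHomUnits ((LinearMap.toMatrixAlgEquiv b : _ →* _).comp ρ)
  have hφ : ∀ g, (φ g : Matrix (Fin d) (Fin d) F) = LinearMap.toMatrixAlgEquiv b (ρ g) :=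
    fun g => rfl
  have hinj : Function.Injective φ := fun g₁ g₂ h12 => by
    have := congrArg Units.val h12
    rw [hφ, hφ] at this
    exact hρ.injective ((LinearMap.toMatrixAlgEquiv b).injective this)
  let e : G ≃* φ.range := φ.ofInjective hinj
  have : Finite φ.range := Finite.of_equiv _ e.toEquiv
  have : Group.IsSolvable φ.range := Group.isSolvable_of_surjective e.surjective
  refine ⟨φ.range, ⟨?_, fun W hW => ?_⟩, ?_⟩
  · have : NeZero d := ⟨by omega⟩
    exact bot_ne_top
  · have hW' : W = (W.comap (b.equivFun : V →ₗ[F] (Fin d → F))).map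
        (b.equivFun : V →ₗ[F] (Fin d → F)) :=
      (Submodule.map_comap_eq_of_surjective b.equivFun.surjective W).symm
    rcases hρ.irreducible (W.comap (b.equivFun : V →ₗ[F] (Fin d → F))) (fun g v hv => by
      have := hW (φ g) ⟨g, rfl⟩ _ hv
      rw [hφ] at this
      rw [Submodule.mem_comap]
      convert this using 1
      exact (LinearMap.toMatrix_mulVec_repr b b (ρ g) v).symm) with h | h
    · left
      rw [hW', h, Submodule.map_bot]
    · right
      rw [hW', h, Submodule.map_top, LinearMap.range_eq_top.2 b.equivFun.surjective]
  · rw [cp_eq_factorization_card, ← hc, Nat.card_congr e.toEquiv]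

/-- The group of signed values `± ψ x` of a projective representation of an elementary abelian
`2`-group with a sign-valued cocycle. -/
def signedRange {K R : Type*} [AddCommGroup K] [Ring R] (c : K → K → ℤˣ) (ψ : K → R)
    (hadd : ∀ x : K, x + x = 0) (h0 : ψ 0 = 1)
    (hmul : ∀ x y, ψ x * ψ y = c x y • ψ (x + y)) : Subgroup Rˣ where
  carrier := {g | ∃ (a : ℤˣ) (x : K), (g : R) = a • ψ x}
  one_mem' := ⟨1, 0, by simp [h0]⟩
  mul_mem' := by
    rintro g h ⟨a, x, hg⟩ ⟨b, y, hh⟩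
    exact ⟨a * b * c x y, x + y, by
      rw [Units.val_mul, hg, hh, smul_mul_smul_comm, hmul, smul_smul]⟩
  inv_mem' := by
    rintro g ⟨a, x, hg⟩
    refine ⟨a * c x x, x, Units.inv_eq_of_mul_eq_one_right ?_⟩
    rw [hg, smul_mul_smul_comm, hmul, smul_smul, hadd, h0, ← mul_assoc, Int.units_mul_self, one_mul,
      Int.units_mul_self, one_smul]

theorem mem_signedRange {K R : Type*} [AddCommGroup K] [Ring R] {c : K → K → ℤˣ} {ψ : K → R}
    {hadd : ∀ x : K, x + x = 0} {h0 : ψ 0 = 1}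
    {hmul : ∀ x y, ψ x * ψ y = c x y • ψ (x + y)} {g : Rˣ} :
    g ∈ signedRange c ψ hadd h0 hmul ↔ ∃ (a : ℤˣ) (x : K), (g : R) = a • ψ x := Iff.rfl

theorem isPGroup_signedRange {K R : Type*} [AddCommGroup K] [Ring R] (c : K → K → ℤˣ) (ψ : K → R)
    (hadd : ∀ x : K, x + x = 0) (h0 : ψ 0 = 1)
    (hmul : ∀ x y, ψ x * ψ y = c x y • ψ (x + y)) :
    IsPGroup 2 (signedRange c ψ hadd h0 hmul) := by
  rintro ⟨g, a, x, hg⟩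
  refine ⟨2, Subtype.ext (Units.ext ?_)⟩
  have hsq : (g : R) * g = c x x • (1 : R) := by
    rw [hg, smul_mul_smul_comm, hmul, smul_smul, hadd, h0, Int.units_mul_self, one_mul]
  have : (g : R) ^ 2 ^ 2 = (g * g) * (g * g) := by
    rw [← mul_assoc, show 2 ^ 2 = 4 from rfl, pow_succ, pow_succ, pow_succ, pow_one]
  simpa [hsq, smul_smul] using this

/-- The `p`-th power map of a finite field of characteristic `p` is surjective. -/
theorem exists_unit_pow_eq {F : Type*} [Field F] [Fintype F] {p f : ℕ} (hf : 0 < f)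
    (hF : Fintype.card F = p ^ f) (l : Fˣ) : ∃ m : Fˣ, m ^ p = l := by
  refine ⟨l ^ p ^ (f - 1), Units.ext ?_⟩
  rw [← pow_mul, ← pow_succ, Nat.sub_add_cancel hf, ← hF, Units.val_pow_eq_pow_val,
    FiniteField.pow_card]

/-- An operator of prime order normalizing a spanning group of signed values of a projective
representation gives a solvable irreducible group. -/
theorem hasSolvableIrrep_of_normalizing {F : Type} [Field F] [Fintype F] {p f : ℕ} (hp : p.Prime)
    (hp2 : p ≠ 2) (hf : 0 < f) (hF : Fintype.card F = p ^ f)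
    {K : Type*} [AddCommGroup K] {V : Type} [AddCommGroup V] [Module F V] [Module.Finite F V]
    [Nontrivial V]
    (c : K → K → ℤˣ) (ψ : K → Module.End F V)
    (hadd : ∀ x : K, x + x = 0) (h0 : ψ 0 = 1) (hmul : ∀ x y, ψ x * ψ y = c x y • ψ (x + y))
    (hspan : Submodule.span F (Set.range ψ) = ⊤)
    (σ : K → K) (hσ : ∀ x, σ^[p] x = x) (hmove : ∃ x, ψ (σ x) ≠ ψ x)
    (T : (Module.End F V)ˣ) (hT : ∀ x, (T : Module.End F V) * ψ x = ψ (σ x) * T) :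
    HasSolvableIrrep F p (Module.finrank F V) 1 := by
  have hcomm : ∀ A : Module.End F V, (∀ x, A * ψ x = ψ x * A) → ∃ l : F, A = algebraMap F _ l := by
    intro A hA
    have hcen : A ∈ Subalgebra.center F (Module.End F V) := by
      rw [Subalgebra.mem_center_iff]
      intro B
      have hB : B ∈ Submodule.span F (Set.range ψ) := hspan ▸ Submodule.mem_top
      induction hB using Submodule.span_induction with
      | mem B hB => obtain ⟨x, rfl⟩ := hB; exact (hA x).symm
      | zero => simp
      | add B C _ _ hB hC => rw [add_mul, mul_add, hB, hC]
      | smul r B _ hB => rw [smul_mul_assoc, mul_smul_comm, hB]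
    obtain ⟨l, hl⟩ := Algebra.mem_bot.1 (Algebra.IsCentral.out hcen)
    exact ⟨l, hl.symm⟩
  have hTpow : ∀ (n : ℕ) (x : K),
      (T : Module.End F V) ^ n * ψ x = ψ (σ^[n] x) * (T : Module.End F V) ^ n := by
    intro n
    induction n with
    | zero => simp
    | succ n ih =>
      intro x
      rw [pow_succ, mul_assoc, hT, ← mul_assoc, ih, Function.iterate_succ_apply, mul_assoc]
  obtain ⟨l, hl⟩ := hcomm ((T : Module.End F V) ^ p) fun x => by rw [hTpow, hσ]
  have hl0 : l ≠ 0 := by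
    rintro rfl
    rw [map_zero, ← Units.val_pow_eq_pow_val] at hl
    exact Units.ne_zero _ hl
  obtain ⟨m, hm⟩ := exists_unit_pow_eq hf hF (Units.mk0 l hl0)
  let s : (Module.End F V)ˣ := Units.map (algebraMap F (Module.End F V) : F →* Module.End F V) m⁻¹
  have hs : ∀ A : Module.End F V, (s : Module.End F V) * A = A * s :=
    fun A => Algebra.commutes _ _
  let U : (Module.End F V)ˣ := s * T
  have hU : ∀ x, (U : Module.End F V) * ψ x = ψ (σ x) * U := fun x => by
    rw [Units.val_mul, mul_assoc, hT, ← mul_assoc, hs, mul_assoc]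
  have hUp : U ^ p = 1 := by
    have hcomm' : Commute s T := Units.ext (hs T)
    have hTp : T ^ p = Units.map (algebraMap F (Module.End F V) : F →* Module.End F V)
        (Units.mk0 l hl0) := Units.ext (by simpa using hl)
    rw [hcomm'.mul_pow, hTp, ← hm, ← map_pow, ← map_mul, inv_pow, inv_mul_cancel, map_one]
  have hU1 : U ≠ 1 := by
    intro h
    obtain ⟨x, hx⟩ := hmove
    have := hU x
    rw [h, Units.val_one, one_mul, mul_one] at this
    exact hx this.symm
  have := Fact.mk hp
  have hord : orderOf U = p := orderOf_eq_prime hUp hU1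
  have : Finite V := Module.finite_of_finite F
  have : Finite (Module.End F V) := DFunLike.finite _
  let E := signedRange c ψ hadd h0 hmul
  have hE : IsPGroup 2 E := isPGroup_signedRange c ψ hadd h0 hmul
  have hnorm : Subgroup.zpowers U ≤ Subgroup.normalizer (E : Set (Module.End F V)ˣ) := by
    rw [Subgroup.zpowers_le]
    refine Subgroup.mem_normalizer_fintype ?_
    rintro g ⟨a, x, hg⟩
    refine ⟨a, σ x, ?_⟩
    rw [Units.val_mul, Units.val_mul, hg, mul_smul_comm, hU, smul_mul_assoc, mul_assoc,
      Units.mul_inv, mul_one]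
  have hcard : Nat.card (Subgroup.zpowers U) = p := by rw [Nat.card_zpowers, hord]
  obtain ⟨r, hr⟩ := hE.exists_card_eq
  have := Fact.mk Nat.prime_two
  have := hE.isNilpotent
  have hcop : (Nat.card E).Coprime p :=
    hr ▸ Nat.Coprime.pow_left r ((Nat.coprime_primes Nat.prime_two hp).2 (Ne.symm hp2))
  let φ := SemidirectProduct.monoidHomSubgroup hnorm
  have hφ : ∀ w, φ w = w.left * w.right := fun w => rfl
  have hmem : ∀ g ∈ E, ∃ w, φ w = g := fun g hg => ⟨⟨⟨g, hg⟩, 1⟩, by simp [hφ]⟩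
  refine ⟨_, inferInstance, V, inferInstance, inferInstance,
    (Units.coeHom (Module.End F V)).comp φ, Finite.of_equiv _ SemidirectProduct.equivProd.symm,
    ?_, ?_, Module.finrank_pos, rfl, ?_, fun W hW => ?_, ?_⟩
  · exact Group.isSolvable_of_ker_le_range SemidirectProduct.inl SemidirectProduct.rightHom
      SemidirectProduct.range_inl_eq_ker_rightHom.ge
  · rw [Nat.card_congr SemidirectProduct.equivProd, Nat.card_prod, hcard, hr,
      Nat.factorization_mul (by positivity) hp.ne_zero, Finsupp.add_apply, hp.factorization_self,
      Nat.Prime.factorization_pow Nat.prime_two, Finsupp.single_eq_of_ne hp2]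
  · refine Units.val_injective.comp ((injective_iff_map_eq_one _).2 fun w hw => ?_)
    rw [hφ] at hw
    have hdisj := Subgroup.disjoint_of_coprime_natCard (H := E) (K := Subgroup.zpowers U)
      (by rwa [hcard])
    obtain ⟨hl, hr⟩ := Subgroup.disjoint_iff_mul_eq_one.1 hdisj w.left.2 w.right.2 hw
    exact SemidirectProduct.ext (Subtype.ext hl) (Subtype.ext hr)
  · by_cases hbot : W = ⊥
    · exact Or.inl hbot
    right
    obtain ⟨w, hw, hw0⟩ := W.exists_mem_ne_zero_of_ne_bot hbot
    have hψ : ∀ x, ∀ v ∈ W, ψ x v ∈ W := by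
      intro x v hv
      let g : (Module.End F V)ˣ := ⟨ψ x, c x x • ψ x, by
        rw [mul_smul_comm, hmul, smul_smul, hadd, h0, Int.units_mul_self, one_smul], by
        rw [smul_mul_assoc, hmul, smul_smul, hadd, h0, Int.units_mul_self, one_smul]⟩
      obtain ⟨y, hy⟩ := hmem g ⟨1, x, (one_smul _ _).symm⟩
      have := hW y v hv
      rwa [MonoidHom.comp_apply, hy] at this
    have hall : ∀ B : Module.End F V, B w ∈ W := by
      intro B
      have hB : B ∈ Submodule.span F (Set.range ψ) := hspan ▸ Submodule.mem_top
      induction hB using Submodule.span_induction with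
      | mem B hB => obtain ⟨x, rfl⟩ := hB; exact hψ x w hw
      | zero => exact W.zero_mem
      | add B C _ _ hB hC => exact W.add_mem hB hC
      | smul r B _ hB => exact W.smul_mem r hB
    refine eq_top_iff.2 fun v _ => ?_
    obtain ⟨d, hd⟩ := Module.Projective.exists_dual_ne_zero F hw0
    simpa [hd] using hall (LinearMap.smulRight ((d w)⁻¹ • d) v)
  · obtain ⟨w, hw⟩ := hmem (-1) ⟨-1, 0, by simp [h0]⟩
    exact ⟨w, by rw [MonoidHom.comp_apply, hw]; rfl⟩

/-- A finite-dimensional central simple algebra over a finite field is a full endomorphism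
algebra. -/
theorem exists_algEquiv_end_of_central_simple (F A : Type*) [Field F] [Finite F] [Ring A]
    [Algebra F A] [Module.Finite F A] [IsSimpleRing A]
    (hcen : ∀ a : A, (∀ b, a * b = b * a) → ∃ l : F, a = algebraMap F A l) :
    ∃ (n : ℕ) (_ : NeZero n), n ^ 2 = Module.finrank F A ∧
      Nonempty (A ≃ₐ[F] Module.End F (Fin n → F)) := by
  have : IsArtinianRing A := IsArtinianRing.of_finite F A
  obtain ⟨n, hn, D, _, _, _, ⟨e⟩⟩ := IsSimpleRing.exists_algEquiv_matrix_divisionRing_finite F A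
  have : Finite D := Module.finite_of_finite F
  have hcommD : ∀ a b : D, a * b = b * a := (littleWedderburn D).mul_comm
  have hsurj : Function.Surjective (algebraMap F D) := by
    intro d
    obtain ⟨l, hl⟩ := hcen (e.symm (Matrix.scalar (Fin n) d)) fun b => by
      apply e.injective
      rw [map_mul, map_mul, e.apply_symm_apply]
      exact Matrix.scalar_commute d (hcommD d) (e b)
    refine ⟨l, ?_⟩
    have := congrArg e hl
    rw [e.apply_symm_apply, e.commutes] at this
    have h00 := congrFun (congrFun this 0) 0
    simpa [Matrix.algebraMap_matrix_apply] using h00.symm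
  let i : F ≃ₐ[F] D := AlgEquiv.ofBijective (Algebra.ofId F D) ⟨(algebraMap F D).injective, hsurj⟩
  let e' : A ≃ₐ[F] Module.End F (Fin n → F) :=
    (e.trans i.symm.mapMatrix).trans Matrix.toLinAlgEquiv'
  refine ⟨n, hn, ?_, ⟨e'⟩⟩
  rw [e'.toLinearEquiv.finrank_eq, Module.finrank_linearMap, Module.finrank_fin_fun, sq]

/-- A finite family of signed symbols `ψ x` in an algebra multiplying according to a
nondegenerate sign-valued bicharacter, and spanning the algebra. -/
structure IsTwistedFamily (F : Type*) {K A : Type*} [Field F] [AddCommGroup K] [Ring A]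
    [Algebra F A] (c : K → K → ℤˣ) (ψ : K → A) : Prop where
  add_self : ∀ x : K, x + x = 0
  map_zero : ψ 0 = 1
  map_mul : ∀ x y, ψ x * ψ y = c x y • ψ (x + y)
  add_left : ∀ x y z, c (x + y) z = c x z * c y z
  add_right : ∀ x y z, c x (y + z) = c x y * c x z
  nondegenerate : ∀ x, x ≠ 0 → ∃ y, c y x * c x y = -1
  span : Submodule.span F (Set.range ψ) = ⊤

namespace IsTwistedFamily

variable {F K A : Type*} [Field F] [AddCommGroup K] [Ring A] [Algebra F A]
  {c : K → K → ℤˣ} {ψ : K → A}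

theorem conj_apply (h : IsTwistedFamily F c ψ) (x y : K) :
    c y y • (ψ y * ψ x * ψ y) = (c y x * c x y) • ψ x := by
  have hxy : y + x + y = x := by rw [add_right_comm, h.add_self, zero_add]
  rw [h.map_mul, smul_mul_assoc, h.map_mul, smul_smul, smul_smul, hxy, h.add_left]
  congr 1
  calc c y y * c y x * (c y y * c x y) = (c y y * c y y) * (c y x * c x y) := by ac_rfl
    _ = _ := by rw [Int.units_mul_self, one_mul]

theorem sum_conj_apply [Fintype K] [DecidableEq K] (h : IsTwistedFamily F c ψ) (x : K) :
    ∑ y, c y y • (ψ y * ψ x * ψ y) = if x = 0 then (Fintype.card K : F) • (1 : A) else 0 := by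
  simp_rw [h.conj_apply]
  split_ifs with hx
  · subst hx
    have hl : ∀ y, c 0 y = 1 := fun y => by simpa using h.add_left 0 0 y
    have hr : ∀ y, c y 0 = 1 := fun y => by simpa using h.add_right y 0 0
    simp [hl, hr, h.map_zero, Nat.cast_smul_eq_nsmul]
  · obtain ⟨z, hz⟩ := h.nondegenerate x hx
    have hsum : ∑ y, ((c y x * c x y : ℤˣ) : ℤ) = 0 := by
      have hshift := Equiv.sum_comp (Equiv.addRight z) fun y => ((c y x * c x y : ℤˣ) : ℤ)
      have hneg : ∀ y, c (y + z) x * c x (y + z) = -(c y x * c x y) := fun y => by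
        rw [h.add_left, h.add_right, mul_mul_mul_comm, hz, mul_neg_one]
      simp only [Equiv.coe_addRight, hneg, Units.val_neg, Finset.sum_neg_distrib] at hshift
      omega
    simp_rw [Units.smul_def, ← Finset.sum_smul, hsum, zero_smul]

theorem sum_conj_mul [Fintype K] (h : IsTwistedFamily F c ψ) (a : K → F) (w : K) :
    ∑ y, c y y • (ψ y * (ψ w * ∑ x, a x • ψ x) * ψ y) =
      c w w • ((Fintype.card K : F) * a w) • (1 : A) := by
  classical
  calc ∑ y, c y y • (ψ y * (ψ w * ∑ x, a x • ψ x) * ψ y)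
      = ∑ x, c w x • a x • ∑ y, c y y • (ψ y * ψ (w + x) * ψ y) := by
        simp_rw [Finset.mul_sum, Finset.sum_mul, Finset.smul_sum]
        rw [Finset.sum_comm]
        refine Finset.sum_congr rfl fun x _ => Finset.sum_congr rfl fun y _ => ?_
        rw [mul_smul_comm, h.map_mul, mul_smul_comm, smul_mul_assoc, mul_smul_comm, smul_mul_assoc,
          smul_comm (c y y), smul_comm (c y y), smul_comm (a x)]
    _ = _ := by
        rw [Finset.sum_eq_single w]
        · rw [h.sum_conj_apply, if_pos (h.add_self w), smul_smul (a w), mul_comm]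
        · intro x _ hx
          have : w + x ≠ 0 := fun h0 => hx (add_left_cancel (h0.trans (h.add_self w).symm))
          rw [h.sum_conj_apply, if_neg this, smul_zero, smul_zero]
        · simp

theorem exists_eq_sum [Fintype K] (h : IsTwistedFamily F c ψ) (a : A) :
    ∃ v : K → F, ∑ x, v x • ψ x = a :=
  (Submodule.mem_span_range_iff_exists_fun F).1 (h.span ▸ Submodule.mem_top)

theorem linearIndependent [Fintype K] [Nontrivial A] (h : IsTwistedFamily F c ψ)
    (hK : (Fintype.card K : F) ≠ 0) : LinearIndependent F ψ := by
  refine Fintype.linearIndependent_iff.2 fun a ha w => ?_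
  have := h.sum_conj_mul a w
  simp only [ha, mul_zero, zero_mul, smul_zero, Finset.sum_const_zero] at this
  simpa [hK] using (smul_eq_zero_iff_eq _).1 this.symm

theorem isSimpleRing [Fintype K] [Nontrivial A] (h : IsTwistedFamily F c ψ)
    (hK : (Fintype.card K : F) ≠ 0) : IsSimpleRing A := by
  refine ⟨⟨fun I => ?_⟩⟩
  by_cases hI : I = ⊥
  · exact Or.inl hI
  right
  obtain ⟨a, haI, ha⟩ : ∃ a ∈ I, a ≠ 0 := by
    by_contra hcon
    push Not at hcon
    exact hI (eq_bot_iff.2 fun a ha => (TwoSidedIdeal.mem_bot _).2 (hcon a ha))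
  obtain ⟨v, rfl⟩ := h.exists_eq_sum a
  obtain ⟨w, hw⟩ : ∃ w, v w ≠ 0 := by
    by_contra hcon
    push Not at hcon
    simp [hcon] at ha
  have hmem : ∑ y, c y y • (ψ y * (ψ w * ∑ x, v x • ψ x) * ψ y) ∈ I := by
    refine sum_mem fun y _ => ?_
    rw [Units.smul_def]
    exact zsmul_mem (I.mul_mem_right _ _ (I.mul_mem_left _ _ (I.mul_mem_left _ _ haI))) _
  rw [h.sum_conj_mul, Units.smul_def] at hmem
  have hone := zsmul_mem hmem (c w w : ℤ)
  rw [smul_smul, ← Units.val_mul, Int.units_mul_self, Units.val_one, one_smul,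
    ← Algebra.algebraMap_eq_smul_one] at hone
  rw [← TwoSidedIdeal.one_mem_iff]
  have := I.mul_mem_left (algebraMap F A ((Fintype.card K : F) * v w)⁻¹) _ hone
  rwa [← _root_.map_mul, inv_mul_cancel₀ (mul_ne_zero hK hw), map_one] at this

theorem eq_algebraMap_of_central [Fintype K] (h : IsTwistedFamily F c ψ)
    (hK : (Fintype.card K : F) ≠ 0) (a : A) (ha : ∀ b, a * b = b * a) :
    ∃ l : F, a = algebraMap F A l := by
  obtain ⟨v, rfl⟩ := h.exists_eq_sum a
  refine ⟨v 0, ?_⟩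
  have key := h.sum_conj_mul v 0
  have h00 : c 0 0 = 1 := by simpa using h.add_left 0 0 0
  have hterm : ∀ y, c y y • (ψ y * (ψ 0 * ∑ x, v x • ψ x) * ψ y) = ∑ x, v x • ψ x := fun y => by
    rw [h.map_zero, one_mul, ← ha, mul_assoc, h.map_mul, h.add_self, mul_smul_comm, smul_smul,
      Int.units_mul_self, one_smul, h.map_zero, mul_one]
  rw [Finset.sum_congr rfl fun y _ => hterm y, Finset.sum_const, Finset.card_univ, h00, one_smul,
    mul_smul, ← Nat.cast_smul_eq_nsmul F] at key
  rw [Algebra.algebraMap_eq_smul_one]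
  exact smul_right_injective A hK key

/-- An isometry of the bicharacter permutes the symbols by an algebra automorphism. -/
theorem exists_algEquiv [Fintype K] [Nontrivial A] (h : IsTwistedFamily F c ψ)
    (hK : (Fintype.card K : F) ≠ 0) (σ : K ≃+ K) (hσ : ∀ x y, c (σ x) (σ y) = c x y) :
    ∃ s : A ≃ₐ[F] A, ∀ x, s (ψ x) = ψ (σ x) := by
  let b : Module.Basis K F A := .mk (h.linearIndependent hK) h.span.ge
  have hb : ∀ x, b x = ψ x := fun x => by simp [b]
  let s : A ≃ₗ[F] A := b.equiv b σ.toEquiv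
  have hs : ∀ x, s (ψ x) = ψ (σ x) := fun x => by
    rw [← hb, b.equiv_apply, hb]; rfl
  refine ⟨AlgEquiv.ofLinearEquiv s ?_ ?_, hs⟩
  · rw [← h.map_zero, hs, _root_.map_zero]
  · have hbil : (LinearMap.mul F A).compr₂ (s : A →ₗ[F] A) =
        (LinearMap.mul F A).compl₁₂ (s : A →ₗ[F] A) (s : A →ₗ[F] A) := by
      refine b.ext fun x => b.ext fun y => ?_
      simp only [LinearMap.compr₂_apply, LinearMap.compl₁₂_apply, LinearMap.mul_apply',
        LinearEquiv.coe_coe, hb, hs, h.map_mul, hσ, ← map_add]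
      rw [Units.smul_def, Units.smul_def, map_zsmul, hs]
    exact fun x y => LinearMap.congr_fun₂ hbil x y

end IsTwistedFamily

/-- The left regular twisted translation by `x` on functions `K → F`. -/
def twistedTranslation (F : Type*) {K : Type*} [Field F] [AddCommGroup K] (c : K → K → ℤˣ) (x : K) :
    Module.End F (K → F) where
  toFun v y := c x (y + x) • v (y + x)
  map_add' v w := by ext y; simp
  map_smul' r v := by ext y; simp [mul_smul_comm]

/-- Every nondegenerate sign-valued bicharacter is realized by symbols spanning an algebra. -/
theorem exists_isTwistedFamily (F K : Type) [Field F] [AddCommGroup K] (c : K → K → ℤˣ)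
    (hadd : ∀ x : K, x + x = 0) (hleft : ∀ x y z, c (x + y) z = c x z * c y z)
    (hright : ∀ x y z, c x (y + z) = c x y * c x z)
    (hnd : ∀ x, x ≠ 0 → ∃ y, c y x * c x y = -1) :
    ∃ (A : Type) (_ : Ring A) (_ : Algebra F A) (_ : Nontrivial A) (ψ : K → A),
      IsTwistedFamily F c ψ := by
  let L : K → Module.End F (K → F) := twistedTranslation F c
  have h0 : L 0 = 1 := by
    have hl : ∀ y, c 0 y = 1 := fun y => by simpa using hleft 0 0 y
    refine LinearMap.ext fun v => funext fun y => ?_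
    simp [L, twistedTranslation, hl]
  have hmul : ∀ x y, L x * L y = c x y • L (x + y) := by
    intro x y
    refine LinearMap.ext fun v => funext fun z => ?_
    have hz : z + x + y = z + (x + y) := add_assoc _ _ _
    have hzx : z + x = z + (x + y) + y := by
      rw [← add_assoc, add_assoc _ y y, hadd, add_zero]
    simp only [L, twistedTranslation, Module.End.mul_apply, LinearMap.coe_mk, AddHom.coe_mk,
      LinearMap.smul_apply, Pi.smul_apply, smul_smul, hz]
    congr 1
    rw [hzx, hright, hleft]
    ac_rfl
  let S := Submodule.span F (Set.range L)
  have hLS : ∀ x, L x ∈ S := fun x => Submodule.subset_span ⟨x, rfl⟩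
  have hone : (1 : Module.End F (K → F)) ∈ S := h0 ▸ hLS 0
  have hSmul : ∀ a b, a ∈ S → b ∈ S → a * b ∈ S := by
    intro a b ha hb
    have : S * S ≤ S := by
      rw [Submodule.span_mul_span, Submodule.span_le]
      rintro _ ⟨_, ⟨x, rfl⟩, _, ⟨y, rfl⟩, rfl⟩
      simp only [SetLike.mem_coe, hmul, Units.smul_def]
      exact zsmul_mem (hLS _) _
    exact this (Submodule.mul_mem_mul ha hb)
  let A : Subalgebra F (Module.End F (K → F)) := S.toSubalgebra hone hSmul
  let ψ : K → A := fun x => ⟨L x, hLS x⟩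
  refine ⟨A, inferInstance, inferInstance, inferInstance, ψ, hadd, Subtype.ext h0,
    fun x y => Subtype.ext (hmul x y), hleft, hright, hnd, ?_⟩
  refine eq_top_iff.2 fun a _ => ?_
  have hmap : (Submodule.span F (Set.range ψ)).map A.val.toLinearMap = S := by
    rw [Submodule.map_span, ← Set.range_comp]
    rfl
  obtain ⟨b, hb, hba⟩ : (a : Module.End F (K → F)) ∈
      (Submodule.span F (Set.range ψ)).map A.val.toLinearMap := hmap ▸ a.2
  rwa [← Subtype.ext hba]

/-- An isometry of prime order of a nondegenerate sign-valued bicharacter on an elementary abelian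
group of order `r ^ 2` yields a solvable irreducible group of degree `r`. -/
theorem hasSolvableIrrep_of_isometry {F K : Type} [Field F] [Fintype F] [AddCommGroup K]
    [Fintype K] {p f r : ℕ} (hp : p.Prime) (hp2 : p ≠ 2) (hf : 0 < f)
    (hF : Fintype.card F = p ^ f) (hcard : Fintype.card K = r ^ 2) (hrF : (r : F) ≠ 0)
    (c : K → K → ℤˣ) (hadd : ∀ x : K, x + x = 0) (hleft : ∀ x y z, c (x + y) z = c x z * c y z)
    (hright : ∀ x y z, c x (y + z) = c x y * c x z)
    (hnd : ∀ x, x ≠ 0 → ∃ y, c y x * c x y = -1)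
    (σ : K ≃+ K) (hσ : ∀ x y, c (σ x) (σ y) = c x y) (hσp : ∀ x, σ^[p] x = x)
    (hmove : ∃ x, σ x ≠ x) : HasSolvableIrrep F p r 1 := by
  obtain ⟨A, _, _, _, ψ, h⟩ := exists_isTwistedFamily F K c hadd hleft hright hnd
  have hK : (Fintype.card K : F) ≠ 0 := by
    rw [hcard, Nat.cast_pow]
    exact pow_ne_zero 2 hrF
  let b : Module.Basis K F A := .mk (h.linearIndependent hK) h.span.ge
  have : Module.Finite F A := .of_basis b
  have := h.isSimpleRing hK
  obtain ⟨s, hs⟩ := h.exists_algEquiv hK σ hσ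
  obtain ⟨n, _, hn, ⟨e⟩⟩ :=
    exists_algEquiv_end_of_central_simple F A (h.eq_algebraMap_of_central hK)
  have hnr : n = r := by
    rw [Module.finrank_eq_card_basis b, hcard] at hn
    exact Nat.pow_left_injective (by norm_num : 2 ≠ 0) hn
  subst hnr
  obtain ⟨T, hT⟩ := ((e.symm.trans s).trans e).eq_linearEquivConjAlgEquiv
  let U : (Module.End F (Fin n → F))ˣ := LinearMap.GeneralLinearGroup.ofLinearEquiv T
  have hU : ∀ x, (U : Module.End F (Fin n → F)) * e (ψ x) = e (ψ (σ x)) * U := by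
    intro x
    have := congrArg (fun g => g (e (ψ x))) hT
    simp only [AlgEquiv.trans_apply, AlgEquiv.symm_apply_apply, hs] at this
    rw [this]
    refine LinearMap.ext fun v => ?_
    simp [U, LinearEquiv.conjAlgEquiv_apply]
  have hdim : Module.finrank F (Fin n → F) = n := Module.finrank_fin_fun F
  rw [← hdim]
  refine hasSolvableIrrep_of_normalizing hp hp2 hf hF c (fun x => e (ψ x)) hadd ?_ ?_ ?_ σ hσp ?_
    U hU
  · rw [h.map_zero, map_one]
  · intro x y
    rw [← map_mul, h.map_mul, Units.smul_def, map_zsmul, Units.smul_def]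
  · have : Set.range (fun x => e (ψ x)) = e.toLinearMap '' Set.range ψ := by
      rw [← Set.range_comp]
      rfl
    rw [this, ← Submodule.map_span, h.span, Submodule.map_top, LinearMap.range_eq_top]
    exact e.surjective
  · obtain ⟨x, hx⟩ := hmove
    exact ⟨x, fun hcon => hx ((h.linearIndependent hK).injective (e.injective hcon))⟩

/-- For a Fermat prime `p = s + 1`, multiplication by a norm-one element of order `p` of the field
with `s ^ 2` elements is an isometry of a nondegenerate sign-valued bicharacter. -/
theorem hasSolvableIrrep_fermat {F : Type} [Field F] [Fintype F] {p m f : ℕ} (hm : m ≠ 0)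
    (hpm : p = 2 ^ m + 1) (hp : p.Prime) (hf : 0 < f) (hF : Fintype.card F = p ^ f)
    (h2 : (2 : F) ≠ 0) : HasSolvableIrrep F p (2 ^ m) 1 := by
  have hm2 : 2 * m ≠ 0 := by omega
  let K := GaloisField 2 (2 * m)
  have := Fintype.ofFinite K
  let s := 2 ^ m
  have hs1 : 1 < s := Nat.one_lt_two_pow hm
  have hps : p = s + 1 := hpm
  have hcard : Fintype.card K = s ^ 2 := by
    rw [← Nat.card_eq_fintype_card, GaloisField.card 2 _ hm2, ← pow_mul, mul_comm]
  have hpow : ∀ x : K, (x ^ s) ^ s = x := fun x => by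
    rw [← pow_mul, ← sq, ← hcard, FiniteField.pow_card]
  have hfrob : ∀ x y : K, (x + y) ^ s = x ^ s + y ^ s := fun x y => add_pow_char_pow x y 2 m
  have hadd : ∀ x : K, x + x = 0 := CharTwo.add_self_eq_zero
  obtain ⟨t, ht⟩ : ∃ t : K, t ^ s + t ≠ 0 := by
    by_contra! hcon
    have hroots : ∀ x : K, x ∈ (Polynomial.X ^ s - Polynomial.X : Polynomial K).roots := by
      intro x
      rw [Polynomial.mem_roots (FiniteField.X_pow_card_sub_X_ne_zero K hs1)]
      simpa [CharTwo.sub_eq_add] using hcon x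
    have hle : Fintype.card K ≤ s := by
      classical
      calc Fintype.card K
          ≤ (Polynomial.X ^ s - Polynomial.X : Polynomial K).roots.toFinset.card :=
            Finset.card_le_card fun x _ => Multiset.mem_toFinset.2 (hroots x)
        _ ≤ (Polynomial.X ^ s - Polynomial.X : Polynomial K).natDegree :=
            (Multiset.toFinset_card_le _).trans (Polynomial.card_roots' _)
        _ = s := FiniteField.X_pow_card_sub_X_natDegree_eq K hs1
    rw [hcard] at hle
    nlinarith
  obtain ⟨u, hu⟩ : ∃ u : Kˣ, orderOf u = p := by
    have := Fact.mk hp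
    have hdvd : p ∣ Nat.card Kˣ := by
      rw [Nat.card_units, Nat.card_eq_fintype_card, hcard, hps,
        show s ^ 2 - 1 = s ^ 2 - 1 ^ 2 by simp, Nat.sq_sub_sq]
      exact dvd_mul_right _ _
    exact exists_prime_orderOf_dvd_card' p hdvd
  have hup : (u : K) ^ p = 1 := by
    rw [← hu, ← Units.val_pow_eq_pow_val, pow_orderOf_eq_one, Units.val_one]
  have hus : (u : K) * (u : K) ^ s = 1 := by rw [← pow_succ', ← hps, hup]
  have htrace : ∀ x : K, Algebra.trace (ZMod 2) K (x ^ s) = Algebra.trace (ZMod 2) K x := by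
    have htwo : ∀ y : K, Algebra.trace (ZMod 2) K (y ^ 2) = Algebra.trace (ZMod 2) K y := by
      intro y
      have h := Algebra.trace_eq_of_algEquiv
        (FiniteField.frobeniusAlgEquivOfAlgebraic (ZMod 2) K) y
      simpa using h
    have hiter : ∀ (n : ℕ) (y : K),
        Algebra.trace (ZMod 2) K (y ^ 2 ^ n) = Algebra.trace (ZMod 2) K y := by
      intro n
      induction n with
      | zero => simp
      | succ n ih => intro y; rw [pow_succ, pow_mul, htwo, ih]
    exact hiter m
  have hneg : ∀ a : ZMod 2, a ≠ 0 → (-1 : ℤˣ) ^ a = -1 := by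
    intro a ha
    have : a = 1 := by revert ha; revert a; decide
    rw [this, uzpow_one]
  let c : K → K → ℤˣ := fun x y => (-1) ^ Algebra.trace (ZMod 2) K (t * (x * y ^ s))
  let σ : K ≃+ K := DistribMulAction.toAddEquiv K u
  have hσ : ∀ x, σ x = (u : K) * x := fun _ => rfl
  refine hasSolvableIrrep_of_isometry (K := K) hp (by omega) hf hF hcard (by simp [h2]) c hadd
    ?_ ?_ ?_ σ ?_ ?_ ?_
  · intro x y z
    simp only [c]
    rw [← uzpow_add, ← map_add, add_mul, mul_add]
  · intro x y z
    simp only [c]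
    rw [← uzpow_add, ← map_add, hfrob, mul_add, mul_add]
  · intro x hx
    obtain ⟨w, hw⟩ := Algebra.trace_surjective (ZMod 2) K 1
    refine ⟨(((t ^ s + t) * x)⁻¹ * w) ^ s, ?_⟩
    generalize hz : ((t ^ s + t) * x)⁻¹ * w = z
    have hzw : (t ^ s + t) * x * z = w := by
      rw [← hz, mul_inv_cancel_left₀ (mul_ne_zero ht hx)]
    simp only [c]
    rw [← uzpow_add]
    refine hneg _ ?_
    rw [← htrace (t * (z ^ s * x ^ s)), ← map_add, mul_pow, mul_pow, hpow, hpow]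
    rw [show t ^ s * (z * x) + t * (x * z) = (t ^ s + t) * x * z by ring, hzw, hw]
    exact one_ne_zero
  · intro x y
    have : (u : K) * x * ((u : K) * y) ^ s = x * y ^ s := by
      rw [mul_pow, mul_mul_mul_comm, hus, one_mul]
    simp only [c, hσ, this]
  · intro x
    have hiter : ∀ n : ℕ, σ^[n] x = (u : K) ^ n * x := by
      intro n
      induction n with
      | zero => simp
      | succ n ih =>
        rw [Function.iterate_succ_apply', ih, hσ, ← mul_assoc, pow_succ']
    rw [hiter, hup, one_mul]
  · refine ⟨1, fun hcon => hp.one_lt.ne' ?_⟩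
    rw [hσ, mul_one] at hcon
    rw [← hu, orderOf_eq_one_iff, Units.ext_iff, hcon, Units.val_one]

/-- **Example (Ex5).**  Let `p = 2^(2^k) + 1` be a Fermat prime and `q` a power of `p`.
For every `n ≥ 1` there is an irreducible subgroup `G` of `GL(d, q)`,
`d = (p − 1)·p^{n-1}`, with `(p − 1)^2·c_p(G) = p·d − (p − 1)`. -/
theorem exists_irreducible_subgroup_cp_eq_fermat (p k f n d : ℕ)
    (hpk : p = 2 ^ 2 ^ k + 1) (hp : p.Prime) (hf : 0 < f) (hn : 1 ≤ n)
    (hd : d = (p - 1) * p ^ (n - 1))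
    (F : Type) [Field F] [Fintype F] (hF : Fintype.card F = p ^ f) :
    ∃ G : Subgroup (Matrix.GeneralLinearGroup (Fin d) F),
      natIrreducible G ∧ (p - 1) ^ 2 * cp p ↥G = p * d - (p - 1) := by
  have hodd : Odd p := by
    rw [hpk]
    exact (Nat.even_pow.2 ⟨even_two, pow_ne_zero k two_ne_zero⟩).add_one
  have h2 : (2 : F) ≠ 0 := by
    have := FiniteField.cast_card_eq_zero F
    intro hcon
    rw [hF] at this
    obtain ⟨j, hj⟩ := hodd.pow (n := f)
    rw [hj] at this
    simp [hcon] at this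
  have key : ∀ j : ℕ,
      HasSolvableIrrep F p ((p - 1) * p ^ j) (∑ i ∈ Finset.range (j + 1), p ^ i) := by
    intro j
    induction j with
    | zero =>
      have hbase := hasSolvableIrrep_fermat (pow_ne_zero k two_ne_zero) hpk hp hf hF h2
      simpa [hpk] using hbase
    | succ j ih =>
      have hstep := ih.wreath hp h2
      rw [Finset.sum_range_succ', pow_zero]
      simp_rw [pow_succ', ← Finset.mul_sum]
      rwa [mul_left_comm]
  obtain ⟨G, hG, hcp⟩ := (key (n - 1)).exists_subgroup
  subst hd
  refine ⟨G, hG, ?_⟩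
  have hgeom := Nat.geomSum_eq hp.two_le n
  rw [hcp, Nat.sub_add_cancel hn, hgeom]
  have hdvd : p - 1 ∣ p ^ n - 1 := by simpa using Nat.sub_dvd_pow_sub_pow p 1 n
  rw [sq, mul_assoc, Nat.mul_div_cancel' hdvd, mul_left_comm, ← pow_succ', Nat.sub_add_cancel hn,
    Nat.mul_sub, mul_one]
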